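/- Define h : ℝ → ℝ by h(ξ) = |cos ξ| + |sin ξ|, and for λ > 0 and k ∈ ℕ set τ_k = π(k − 1/2)/(2λ²). There exists j₀ ∈ ℕ, independent of λ, such that for every λ > 0, every integer j ≥ j₀, and every τ ∈ [τ_{j−2}, τ_j], there exist real numbers μ₋ and μ₊ with λ² (τ_j − τ)/(5j) ≤ μ₋ ≤ 4/√j and 1/(πj) ≤ μ₊ ≤ 4/√j such that both ξ₋ = πj/2 − π/4 − μ₋ and ξ₊ = πj/2 − π/4 + μ₊ satisfy the equation ξ · h(ξ)² = 2τλ². -/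

import Mathlib

open Real

/-- The function `h(ξ) = |cos ξ| + |sin ξ|`. -/
noncomputable def h (ξ : ℝ) : ℝ := |Real.cos ξ| + |Real.sin ξ|

/-- The collision time of index `k` (as a real parameter): `τ_k = π(k − 1/2)/(2λ²)`. -/
noncomputable def τfun (lam k : ℝ) : ℝ := π * (k - 1 / 2) / (2 * lam ^ 2)

theorem h_sq (ξ : ℝ) : h ξ ^ 2 = 1 + |Real.sin (2 * ξ)| := by
  unfold h
  rw [Real.sin_two_mul, add_sq, sq_abs, sq_abs, abs_mul, abs_mul, abs_two]
  linarith [Real.sin_sq_add_cos_sq ξ]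

/-- Near the corner `πj/2 − π/4` the function `h²` is `2 cos²` of the distance to the corner. -/
theorem h_sq_near_corner (j : ℕ) {s : ℝ} (hs : |s| ≤ π / 4) :
    h (π * j / 2 - π / 4 + s) ^ 2 = 2 * Real.cos s ^ 2 := by
  obtain ⟨h1, h2⟩ := abs_le.mp hs
  have hcos : 0 ≤ Real.cos (2 * s) := Real.cos_nonneg_of_mem_Icc ⟨by linarith, by linarith⟩
  have harg : 2 * (π * j / 2 - π / 4 + s) = (2 * s + j * π) - π / 2 := by ring
  rw [h_sq, harg, Real.sin_sub_pi_div_two, Real.cos_add_nat_mul_pi, abs_neg, abs_mul, abs_pow,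
    abs_neg, abs_one, one_pow, one_mul, abs_of_nonneg hcos, Real.cos_two_mul]
  ring

theorem half_le_sin {x : ℝ} (hx : 0 ≤ x) (hx' : x ≤ 1) : x / 2 ≤ Real.sin x := by
  have hπ := Real.pi_gt_three
  have hπ' := Real.pi_le_four
  have key := Real.mul_le_sin hx (by linarith)
  have : 1 / 2 ≤ 2 / π := by
    rw [div_le_div_iff₀ two_pos Real.pi_pos]
    linarith
  nlinarith

/-- The branch to the left of the corner, in terms of its distance `x` to the corner. -/
theorem exists_left_branch {J A d m : ℝ}
    (hJ : 100 ≤ J) (hAJ : J + 1 ≤ A) (hA2 : A ≤ 2 * J)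
    (hd0 : 0 ≤ d) (hdπ : d ≤ π) (hm1 : m ≤ 2 / 5) (hJm : 1 / J ≤ m)
    (hsin : 4 ≤ J * Real.sin m ^ 2) :
    ∃ x ∈ Set.Icc (d / (5 * J)) m, (A - x) * (2 * Real.cos x ^ 2) = 2 * A - 2 * d := by
  have hπ := Real.pi_gt_three
  have hπ' := Real.pi_lt_d2
  have hJ0 : 0 < J := by linarith
  have hm0 : 0 < m := (one_div_pos.mpr hJ0).trans_le hJm
  have hle : d / (5 * J) ≤ 1 / J := by
    rw [div_le_div_iff₀ (by positivity) hJ0]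
    nlinarith
  refine intermediate_value_Icc' (hle.trans hJm) (by fun_prop) ⟨?_, ?_⟩
  · simp only [Real.cos_sq']
    nlinarith [mul_nonneg (by linarith : 0 ≤ A - m - J) (sq_nonneg (Real.sin m))]
  · set x := d / (5 * J) with hx
    have hx0 : 0 ≤ x := by positivity
    have hxj : x * J = d / 5 := by
      rw [hx]
      field_simp
    have hx1 : x ≤ 1 := by nlinarith
    have hxA : x * A ≤ 2 * (d / 5) := by nlinarith
    have hxd : 100 * x ≤ d / 5 := by nlinarith
    have h1 : A * Real.sin x ^ 2 ≤ A * x ^ 2 :=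
      mul_le_mul_of_nonneg_left Real.sin_sq_le_sq (by linarith)
    have h2 : A * x ^ 2 ≤ x * A := by
      have hxA0 : 0 ≤ x * A := mul_nonneg hx0 (by linarith)
      calc A * x ^ 2 = x * A * x := by ring
        _ ≤ x * A := mul_le_of_le_one_right hxA0 hx1
    simp only [Real.cos_sq']
    linarith [mul_nonneg hx0 (sq_nonneg (Real.sin x))]

/-- The branch to the right of the corner, in terms of its distance `x` to the corner. -/
theorem exists_right_branch {J A d m : ℝ}
    (hJ : 100 ≤ J) (hAJ : J + 1 ≤ A) (hA2 : A + 1 ≤ π * J)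
    (hd0 : 0 ≤ d) (hdπ : d ≤ π) (hm1 : m ≤ 2 / 5) (hJm : 1 / J ≤ m)
    (hsin : 4 ≤ J * Real.sin m ^ 2) :
    ∃ x ∈ Set.Icc (1 / (π * J)) m, (A + x) * (2 * Real.cos x ^ 2) = 2 * A - 2 * d := by
  have hπ := Real.pi_gt_three
  have hπ' := Real.pi_lt_d2
  have hJ0 : 0 < J := by linarith
  have hm0 : 0 < m := (one_div_pos.mpr hJ0).trans_le hJm
  have hle : 1 / (π * J) ≤ 1 / J :=
    one_div_le_one_div_of_le hJ0 (by nlinarith)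
  refine intermediate_value_Icc' (hle.trans hJm) (by fun_prop) ⟨?_, ?_⟩
  · simp only [Real.cos_sq']
    nlinarith [mul_nonneg (by linarith : 0 ≤ A + m - J) (sq_nonneg (Real.sin m))]
  · have hx1 : 1 / (π * J) ≤ 1 := (hle.trans hJm).trans (by linarith)
    set x := 1 / (π * J) with hx
    have hx0 : 0 ≤ x := by positivity
    have hxj : x * (π * J) = 1 := by
      rw [hx]
      field_simp
    have hxA : x * (A + x) ≤ 1 := by nlinarith
    have h1 : (A + x) * Real.sin x ^ 2 ≤ (A + x) * x ^ 2 :=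
      mul_le_mul_of_nonneg_left Real.sin_sq_le_sq (by linarith)
    have h2 : (A + x) * x ^ 2 ≤ x := by nlinarith
    simp only [Real.cos_sq']
    nlinarith

/-- For all large `j` (uniformly in `λ`) and all `τ ∈ [τ_{j−2}, τ_j]`, the equation
`ξ h(ξ)² = 2τλ²` has two solutions of the form `πj/2 − π/4 ∓ μ` with quantitative
bounds on `μ₋` and `μ₊`. -/
theorem two_branches_near_the_corner :
    ∃ j₀ : ℕ, ∀ lam : ℝ, 0 < lam → ∀ j : ℕ, j₀ ≤ j →
      ∀ τ ∈ Set.Icc (τfun lam ((j : ℝ) - 2)) (τfun lam (j : ℝ)),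
        ∃ μm μp : ℝ,
          (lam ^ 2 * (τfun lam (j : ℝ) - τ) / (5 * j) ≤ μm ∧ μm ≤ 4 / Real.sqrt j) ∧
          (1 / (π * j) ≤ μp ∧ μp ≤ 4 / Real.sqrt j) ∧
          (π * j / 2 - π / 4 - μm) * h (π * j / 2 - π / 4 - μm) ^ 2 = 2 * τ * lam ^ 2 ∧
          (π * j / 2 - π / 4 + μp) * h (π * j / 2 - π / 4 + μp) ^ 2 = 2 * τ * lam ^ 2 := by
  refine ⟨100, fun lam hlam j hj τ hτ => ?_⟩
  have hπ := Real.pi_gt_three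
  have hπ' := Real.pi_lt_d2
  have hj' : (100 : ℝ) ≤ j := by exact_mod_cast hj
  have hj0 : (0 : ℝ) < j := by linarith
  obtain ⟨hτ1, hτ2⟩ := hτ
  have hτj : ∀ k : ℝ, lam ^ 2 * τfun lam k = π * (k - 1 / 2) / 2 := by
    intro k
    unfold τfun
    field_simp
  have hl : 0 < lam ^ 2 := by positivity
  set A : ℝ := π * j / 2 - π / 4 with hA
  have hAj : j + 1 ≤ A := by nlinarith
  set d : ℝ := lam ^ 2 * (τfun lam j - τ) with hd
  have hd0 : 0 ≤ d := mul_nonneg hl.le (by linarith)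
  have hdπ : d ≤ π := by
    have := mul_le_mul_of_nonneg_left hτ1 hl.le
    rw [hτj] at this
    rw [hd, mul_sub, hτj]
    linarith
  have hT : 2 * τ * lam ^ 2 = 2 * A - 2 * d := by
    rw [hd, hA]
    linear_combination 2 * hτj j
  have hr : 10 ≤ √(j : ℝ) := Real.le_sqrt_of_sq_le (by linarith)
  have hr2 : √(j : ℝ) ^ 2 = j := Real.sq_sqrt hj0.le
  set m : ℝ := 4 / √(j : ℝ) with hm
  have hm0 : 0 < m := by positivity
  have hm1 : m ≤ 2 / 5 := by
    rw [hm, div_le_iff₀ (by linarith)]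
    linarith
  have hm2 : j * m ^ 2 = 16 := by
    rw [hm, div_pow, hr2]
    field_simp
    norm_num
  have hjm : 1 / j ≤ m := by
    rw [div_le_iff₀ hj0]
    nlinarith
  have hsinm : 4 ≤ j * Real.sin m ^ 2 := by
    have := pow_le_pow_left₀ (by positivity) (half_le_sin hm0.le (by linarith)) 2
    nlinarith
  obtain ⟨x, ⟨hx1, hx2⟩, hx⟩ :=
    exists_left_branch hj' hAj (by nlinarith) hd0 hdπ hm1 hjm hsinm
  obtain ⟨y, ⟨hy1, hy2⟩, hy⟩ :=
    exists_right_branch hj' hAj (by nlinarith) hd0 hdπ hm1 hjm hsinm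
  have hx0 : 0 ≤ x := le_trans (by positivity) hx1
  have hy0 : 0 ≤ y := le_trans (by positivity) hy1
  refine ⟨x, y, ⟨hx1, hx2⟩, ⟨hy1, hy2⟩, ?_, ?_⟩
  · rw [hT, ← hx, ← Real.cos_neg x, sub_eq_add_neg A x, hA, h_sq_near_corner]
    rw [abs_neg, abs_of_nonneg hx0]
    linarith
  · rw [hT, ← hy, hA, h_sq_near_corner]
    rw [abs_of_nonneg hy0]
    linarith
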